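/- The two hypermatrices e₁' = (1/2)•[(+,+,−,−) − (+,−,−,+)] and e₂' = (1/2)•[(+,+,−,−) + (+,−,−,+)] lie in distinct G-orbits: there is no g ∈ G with g·e₁' = e₂'. -/

import Mathlib

/-- The space of real 2×2×2×2 hypermatrices. -/
abbrev V : Type := Fin 2 → Fin 2 → Fin 2 → Fin 2 → ℝ

/-- The group `SL₂(ℝ)⁴`. -/
abbrev G : Type :=
  Matrix.SpecialLinearGroup (Fin 2) ℝ × Matrix.SpecialLinearGroup (Fin 2) ℝ ×
    Matrix.SpecialLinearGroup (Fin 2) ℝ × Matrix.SpecialLinearGroup (Fin 2) ℝ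

/-- The natural linear action of `G = SL₂(ℝ)⁴` on `V`. -/
noncomputable def actG (g : G) (T : V) : V := fun i₁ i₂ i₃ i₄ =>
  ∑ j₁ : Fin 2, ∑ j₂ : Fin 2, ∑ j₃ : Fin 2, ∑ j₄ : Fin 2,
    (g.1 : Matrix (Fin 2) (Fin 2) ℝ) i₁ j₁ * (g.2.1 : Matrix (Fin 2) (Fin 2) ℝ) i₂ j₂ *
      (g.2.2.1 : Matrix (Fin 2) (Fin 2) ℝ) i₃ j₃ * (g.2.2.2 : Matrix (Fin 2) (Fin 2) ℝ) i₄ j₄ *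
      T j₁ j₂ j₃ j₄

/-- The basis hypermatrix with a single `1` at position `(a,b,c,d)`; the sign `+` corresponds to
index `0` and the sign `−` to index `1`. -/
def bv (a b c d : Fin 2) : V := fun i₁ i₂ i₃ i₄ =>
  if i₁ = a ∧ i₂ = b ∧ i₃ = c ∧ i₄ = d then 1 else 0

/-- `(+,+,−,−)` -/ noncomputable def x₇ : V := bv 0 0 1 1
/-- `(+,−,−,+)` -/ noncomputable def y₇ : V := bv 0 1 1 0

/-- The entries of `g·e₁'` in the slice `i₁ = +`, `i₃ = −`. -/
lemma actG_e₁'_apply (g : G) (i j : Fin 2) :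
    actG g ((1 / 2 : ℝ) • (x₇ - y₇)) 0 i 1 j =
      g.1 0 0 * g.2.2.1 1 1 / 2 * (g.2.1 i 0 * g.2.2.2 j 1 - g.2.1 i 1 * g.2.2.2 j 0) := by
  simp [actG, x₇, y₇, bv, Fin.sum_univ_two]
  ring

/-- The determinant of the slice `i₁ = +`, `i₃ = −` of `g·e₁'` is a square. -/
lemma det_slice_actG_e₁' (g : G) :
    (Matrix.of fun i j => actG g ((1 / 2 : ℝ) • (x₇ - y₇)) 0 i 1 j).det =
      (g.1 0 0 * g.2.2.1 1 1 / 2) ^ 2 := by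
  have hb := g.2.1.det_coe
  have hd := g.2.2.2.det_coe
  rw [Matrix.det_fin_two] at hb hd
  simp only [Matrix.det_fin_two, Matrix.of_apply, actG_e₁'_apply]
  linear_combination (g.1 0 0 * g.2.2.1 1 1 / 2) ^ 2 *
    ((g.2.2.2 0 0 * g.2.2.2 1 1 - g.2.2.2 0 1 * g.2.2.2 1 0) * hb + hd)

/-- The determinant of the slice `i₁ = +`, `i₃ = −` of `e₂'` is negative. -/
lemma det_slice_e₂' :
    (Matrix.of fun i j => ((1 / 2 : ℝ) • (x₇ + y₇)) 0 i 1 j).det = -(1 / 4) := by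
  norm_num [Matrix.det_fin_two, x₇, y₇, bv]

/-- The hypermatrices `e₁' = (1/2)•[(+,+,−,−) − (+,−,−,+)]` and
`e₂' = (1/2)•[(+,+,−,−) + (+,−,−,+)]` lie in distinct `G`-orbits. -/
theorem distinct_orbits_e₁'_e₂' :
    ¬ ∃ g : G, actG g ((1 / 2 : ℝ) • (x₇ - y₇)) = (1 / 2 : ℝ) • (x₇ + y₇) := by
  rintro ⟨g, hg⟩
  have h := det_slice_actG_e₁' g
  rw [hg, det_slice_e₂'] at h
  linarith [sq_nonneg (g.1 0 0 * g.2.2.1 1 1 / 2)]
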